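/- Let n, l ∈ ℕ, let λ be a partition of n with λ'_1 ≤ l ≤ n, and let R be a standard Young tableau of shape λ. Then there exists T ∈ SYT((∞^l)) such that T restricts to R (i.e., T_{i,j} = R_{i,j} for every box (i,j) of λ) and jdt^n(T) = T. -/

import Mathlib

open scoped Classical

/-- A 0-based box `(i, j)` belongs to the infinite shape with `l` rows
(`l = ⊤` gives the shape `(∞^∞)`, `l = (l₀ : ℕ∞)` gives `(∞^l₀)`).
Throughout, boxes are 0-based: the paper's box `(i, j)` (with row `i ≥ 1` and
column `j ≥ 1`) corresponds to `(i - 1, j - 1)`. -/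
def Box (l : ℕ∞) (b : ℕ × ℕ) : Prop := (b.1 : ℕ∞) < l

/-- `T` is an infinite standard Young tableau of the shape given by `Box l`:
entries are positive integers on the shape (and the junk value `0` off the shape),
`T` is a bijection from the boxes of the shape onto the positive integers, and
`T` is strictly increasing along rows and columns. -/
structure IsSYT (l : ℕ∞) (T : ℕ × ℕ → ℕ) : Prop where
  zero_outside : ∀ b : ℕ × ℕ, ¬ Box l b → T b = 0
  pos : ∀ b : ℕ × ℕ, Box l b → 0 < T b
  inj : ∀ b c : ℕ × ℕ, Box l b → Box l c → T b = T c → b = c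
  surj : ∀ n : ℕ, 0 < n → ∃ b : ℕ × ℕ, Box l b ∧ T b = n
  row_lt : ∀ b : ℕ × ℕ, Box l b → T b < T (b.1, b.2 + 1)
  col_lt : ∀ b : ℕ × ℕ, Box l (b.1 + 1, b.2) → T b < T (b.1 + 1, b.2)

/-- The sliding path of the filling `T` inside the set `D` of boxes, started at the
box `c`: at each step the empty box moves to whichever of the boxes directly below
or directly to the right (among those belonging to `D`) carries the smaller entry;
if neither belongs to `D`, the path stays put (it has terminated). -/
noncomputable def slideFrom (D : ℕ × ℕ → Prop) (T : ℕ × ℕ → ℕ) (c : ℕ × ℕ) : ℕ → ℕ × ℕ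
  | 0 => c
  | n + 1 =>
      let b := slideFrom D T c n
      if D (b.1 + 1, b.2) ∧ D (b.1, b.2 + 1) then
        (if T (b.1 + 1, b.2) < T (b.1, b.2 + 1) then (b.1 + 1, b.2) else (b.1, b.2 + 1))
      else if D (b.1 + 1, b.2) then (b.1 + 1, b.2)
      else if D (b.1, b.2 + 1) then (b.1, b.2 + 1)
      else b

/-- The sliding path `p(T)`, 0-indexed: `slide D T n` is the paper's `p_{n+1}(T)`;
it lies on the antidiagonal `i + j = n` as long as the path has not terminated. -/
noncomputable def slide (D : ℕ × ℕ → Prop) (T : ℕ × ℕ → ℕ) : ℕ → ℕ × ℕ :=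
  slideFrom D T (0, 0)

/-- Jeu de taquin on the set of boxes `D`: the entry `1` in the box `(0,0)` is
deleted, entries slide backwards along the sliding path, and every entry is
decremented by `1`.  A box `b` lies on the sliding path iff
`slide D T (b.1 + b.2) = b`; if moreover the path terminates at `b` (which is only
possible for finite tableaux) the box `b` is vacated (junk value `0`). -/
noncomputable def jdt (D : ℕ × ℕ → Prop) (T : ℕ × ℕ → ℕ) : ℕ × ℕ → ℕ := fun b =>
  if slide D T (b.1 + b.2) = b then
    (if slide D T (b.1 + b.2 + 1) = b then 0
     else T (slide D T (b.1 + b.2 + 1)) - 1)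
  else T b - 1

/-- A 0-based box of the Young diagram of the partition with row lengths `lam`. -/
def YBox (lam : ℕ → ℕ) (b : ℕ × ℕ) : Prop := b.2 < lam b.1

/-- `lam : ℕ → ℕ` (0-based row lengths) is a partition of `n`. -/
structure IsPartition (lam : ℕ → ℕ) (n : ℕ) : Prop where
  antitone : ∀ i : ℕ, lam (i + 1) ≤ lam i
  finite : {b : ℕ × ℕ | YBox lam b}.Finite
  card : {b : ℕ × ℕ | YBox lam b}.ncard = n

/-- `S` is a (finite) standard Young tableau of shape `lam` with `n` boxes:
a filling of the diagram of `lam` by `1, …, n` (with junk value `0` off the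
diagram), strictly increasing along rows and columns. -/
structure IsFinSYT (lam : ℕ → ℕ) (n : ℕ) (S : ℕ × ℕ → ℕ) : Prop where
  zero_outside : ∀ b : ℕ × ℕ, ¬ YBox lam b → S b = 0
  lb : ∀ b : ℕ × ℕ, YBox lam b → 1 ≤ S b
  ub : ∀ b : ℕ × ℕ, YBox lam b → S b ≤ n
  inj : ∀ b c : ℕ × ℕ, YBox lam b → YBox lam c → S b = S c → b = c
  surj : ∀ m : ℕ, 1 ≤ m → m ≤ n → ∃ b : ℕ × ℕ, YBox lam b ∧ S b = m
  row_lt : ∀ b : ℕ × ℕ, YBox lam (b.1, b.2 + 1) → S b < S (b.1, b.2 + 1)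
  col_lt : ∀ b : ℕ × ℕ, YBox lam (b.1 + 1, b.2) → S b < S (b.1 + 1, b.2)

/-- Interlacing patterns, one row per level. -/
structure Val (g : ℕ → ℕ → ℕ) : Prop where
  z : ∀ i, g 0 i = 0
  up : ∀ k i, g k i ≤ g (k+1) i
  dn : ∀ k i, g (k+1) (i+1) ≤ g k i

/-- Row in which level `k` grows when inserting `y`. -/
def rr (g : ℕ → ℕ → ℕ) (y : ℕ) : ℕ → ℕ
  | 0 => 0
  | k+1 => if k ≤ y then 0 else if g k (rr g y k) < g (k+1) (rr g y k) then rr g y k + 1 else rr g y k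

/-- Row insertion. -/
def ins (g : ℕ → ℕ → ℕ) (y : ℕ) : ℕ → ℕ → ℕ := fun k i =>
  if y < k ∧ i = rr g y k then g k i + 1 else g k i

lemma Val.anti {g} (h : Val g) (k i) : g k (i+1) ≤ g k i :=
  (h.up k (i+1)).trans (h.dn k i)

lemma Val.zero {g} (h : Val g) : ∀ k i, k ≤ i → g k i = 0 := by
  intro k
  induction k with
  | zero => intro i _; exact h.z i
  | succ k ih =>
    intro i hi
    obtain ⟨j, rfl⟩ : ∃ j, i = j+1 := ⟨i-1, by omega⟩
    have := h.dn k j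
    have := ih j (by omega)
    omega

lemma rr_base (g y k) (h : k ≤ y+1) : rr g y k = 0 := by
  cases k with
  | zero => rfl
  | succ k => simp only [rr]; rw [if_pos (by omega)]

lemma rr_succ (g y k) (h : y < k) : (g k (rr g y k) < g (k+1) (rr g y k) ∧ rr g y (k+1) = rr g y k + 1) ∨
    (g (k+1) (rr g y k) ≤ g k (rr g y k) ∧ rr g y (k+1) = rr g y k) := by
  rw [rr]; rw [if_neg (by omega)]; split_ifs <;> omega

lemma rr_lt (g y k) (h : y < k) : rr g y k < k := by
  induction k with
  | zero => omega
  | succ k ih =>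
    by_cases hk : k = y
    · subst hk; rw [rr_base _ _ _ le_rfl]; omega
    · have := ih (by omega)
      have := rr_succ g y k (by omega)
      omega

lemma rr_add {g} (hg : Val g) (y k) (h : y < k) : ∀ j, rr g y k = j+1 → g k (j+1) < g k j := by
  induction k with
  | zero => omega
  | succ k ih =>
    intro j hj
    by_cases hk : k = y
    · subst hk; rw [rr_base _ _ _ le_rfl] at hj; omega
    · have ih := ih (by omega)
      rcases rr_succ g y k (by omega) with ⟨h1, h2⟩ | ⟨h1, h2⟩
      · have : rr g y k = j := by omega
        rw [this] at h1
        have := hg.dn k j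
        omega
      · have e : rr g y k = j+1 := by omega
        rw [e] at h1
        have := ih j e
        have := hg.up k j
        omega

lemma ins_le (g y k i) (h : k ≤ y) : ins g y k i = g k i := by
  unfold ins; rw [if_neg (by omega)]

lemma ins_gt (g y k i) (h : y < k) : ins g y k i = g k i + if i = rr g y k then 1 else 0 := by
  unfold ins; split_ifs <;> grind

lemma ins_val {g} (hg : Val g) (y) : Val (ins g y) := by
  constructor
  · intro i; rw [ins_le _ _ _ _ (by omega)]; exact hg.z i
  · intro k i
    have := hg.up k i
    by_cases hk : k ≤ y
    · rw [ins_le _ _ _ _ hk]; unfold ins; split_ifs <;> omega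
    · rw [ins_gt _ _ _ _ (by omega), ins_gt _ _ _ _ (by omega)]
      have := rr_succ g y k (by omega)
      split_ifs <;> grind
  · intro k i
    have := hg.dn k i
    by_cases hk : k ≤ y
    · rw [ins_le _ _ k i hk]
      by_cases hk' : k = y
      · subst hk'; rw [ins_gt _ _ _ _ (by omega), rr_base _ _ _ le_rfl]; simpa
      · rw [ins_le _ _ _ _ (by omega)]; exact this
    · rw [ins_gt _ _ _ _ (by omega), ins_gt _ _ _ _ (by omega)]
      have := rr_succ g y k (by omega)
      have := rr_add hg y k (by omega) i
      split_ifs <;> grind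

/-- `P'` is `P` with `x` column-inserted, along path `c`. -/
structure JRel (x : ℕ) (P P' : ℕ → ℕ → ℕ) (c : ℕ → ℕ) : Prop where
  cx : c x = x
  le : ∀ k i, k ≤ x → P' k i = P k i
  gt : ∀ k i, x < k → P' k i = P k i + if i = c k then 1 else 0
  mono : ∀ k, x ≤ k → c (k+1) ≤ c k
  eq : ∀ k i, x ≤ k → c (k+1) ≤ i → i < c k → P (k+1) (i+1) = P k i

/-- The local jeu de taquin rule. -/
def Sq (μ : ℕ → ℕ) (c r r' c' : ℕ) : Prop :=
  (r ≠ c ∧ r' = r ∧ c' = c) ∨ (r = c ∧ r' = c ∧ c' = c) ∨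
    (r = c ∧ r' = c+1 ∧ c' = c+1 ∧ μ (c+1) = μ c)

lemma rr_congr {P P' : ℕ → ℕ → ℕ} {x : ℕ} (h : ∀ k i, k ≤ x → P' k i = P k i) (y : ℕ) :
    ∀ k, k ≤ x → rr P' y k = rr P y k := by
  intro k
  induction k with
  | zero => intro _; rfl
  | succ k ih =>
    intro hk
    have := ih (by omega)
    simp only [rr, this, h k _ (by omega), h (k+1) _ hk]

/-- One step of the square induction (general levels). -/
lemma step_gen (μ M : ℕ → ℕ) (c C r r' c' R R' C' : ℕ)
    (hup : ∀ i, μ i ≤ M i) (hdn : ∀ i, M (i+1) ≤ μ i)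
    (hC : C ≤ c) (heq : ∀ i, C ≤ i → i < c → M (i+1) = μ i)
    (hr : ∀ j, r = j+1 → μ (j+1) < μ j)
    (hr' : ∀ j, r' = j+1 → μ (j+1) + (if j+1 = c then 1 else 0) < μ j + (if j = c then 1 else 0))
    (hR : (μ r < M r ∧ R = r+1) ∨ (M r ≤ μ r ∧ R = r))
    (hR' : (μ r' + (if r' = c then 1 else 0) < M r' + (if r' = C then 1 else 0) ∧ R' = r'+1) ∨
      (M r' + (if r' = C then 1 else 0) ≤ μ r' + (if r' = c then 1 else 0) ∧ R' = r'))
    (hC' : C' = if R = C then R' else C)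
    (hs : Sq μ c r r' c') :
    Sq M C R R' C' ∧ C' ≤ c' ∧ ∀ i, C' ≤ i → i < c' →
      M (i+1) + (if i+1 = R then 1 else 0) = μ i + (if i = r then 1 else 0) := by
  have key : ∀ j, r = j+1 → C ≤ j → j < c → R = r+1 := by
    intro j h1 h2 h3
    have := heq j h2 h3
    have := hr j h1
    subst h1
    omega
  rcases hs with ⟨h1, h2, h3⟩ | ⟨h1, h2, h3⟩ | ⟨h1, h2, h3, h4⟩
  · subst h2 h3
    rw [if_neg h1] at hR'
    have hSq : Sq M C R R' C' := by
      unfold Sq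
      by_cases h : r' = C
      · have := heq C le_rfl (by omega)
        subst h
        have := hup r'
        grind
      · grind
    refine ⟨hSq, ?_, ?_⟩
    · unfold Sq at hSq
      by_cases h : r' = C
      · grind
      · grind
    · intro i hi hi'
      have e := heq i (by unfold Sq at hSq; omega) hi'
      have := key i
      have := key (r'-1)
      unfold Sq at hSq
      by_cases h : r' = C
      · grind
      · grind
  · subst h1 h2 h3
    by_cases h : C = c'
    · subst h
      unfold Sq
      refine ⟨?_, ?_, ?_⟩ <;> grind
    · obtain ⟨j, rfl⟩ : ∃ j, c' = j+1 := ⟨c'-1, by omega⟩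
      have := heq j (by omega) (by omega)
      have := hr' j rfl
      have hRe := key j rfl (by omega) (by omega)
      unfold Sq
      refine ⟨?_, ?_, ?_⟩
      · grind
      · grind
      · intro i hi hi'
        have := heq i (by grind) hi'
        grind
  · subst h1 h2 h3
    have a1 := hdn r
    have a2 := hup (r+1)
    have hk : C < r → R = r+1 := fun h => key (r-1) (by omega) (by omega) (by omega)
    have hR'e : R' = r+1 := by grind
    have hSq : Sq M C R R' C' := by
      unfold Sq
      by_cases h : C < r
      · grind
      · have : C = r := by omega
        subst this
        grind
    refine ⟨hSq, ?_, ?_⟩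
    · unfold Sq at hSq; grind
    · intro i hi hi'
      unfold Sq at hSq
      by_cases h : i = r
      · subst h
        grind
      · have := heq i (by omega) (by omega)
        grind

/-- The step from level `x` to level `x+1`. -/
lemma step_x (μ M : ℕ → ℕ) (x C r R R' C' : ℕ)
    (hup : ∀ i, μ i ≤ M i)
    (hC : C ≤ x) (heq : ∀ i, C ≤ i → i < x → M (i+1) = μ i) (hrx : r < x)
    (hr : ∀ j, r = j+1 → μ (j+1) < μ j)
    (hR : (μ r < M r ∧ R = r+1) ∨ (M r ≤ μ r ∧ R = r))
    (hR' : (μ r < M r + (if r = C then 1 else 0) ∧ R' = r+1) ∨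
      (M r + (if r = C then 1 else 0) ≤ μ r ∧ R' = r))
    (hC' : C' = if R = C then R' else C) :
    Sq M C R R' C' ∧ C' ≤ x ∧ ∀ i, C' ≤ i → i < x →
      M (i+1) + (if i+1 = R then 1 else 0) = μ i + (if i = r then 1 else 0) := by
  have key : ∀ j, r = j+1 → C ≤ j → j < x → R = r+1 := by
    intro j h1 h2 h3
    have := heq j h2 h3
    have := hr j h1
    subst h1
    omega
  have hSq : Sq M C R R' C' := by
    unfold Sq
    by_cases h : r = C
    · have := heq C le_rfl (by omega)
      subst h
      have := hup r
      grind
    · grind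
  refine ⟨hSq, ?_, ?_⟩
  · unfold Sq at hSq
    by_cases h : r = C
    · grind
    · grind
  · intro i hi hi'
    have e := heq i (by unfold Sq at hSq; omega) hi'
    have := key i
    have := key (r-1)
    unfold Sq at hSq
    by_cases h : r = C
    · grind
    · grind

lemma sq_sum {μ : ℕ → ℕ} {c r r' c' : ℕ} (h : Sq μ c r r' c') (a i : ℕ) :
    a + (if i = c then 1 else 0) + (if i = r' then 1 else 0) =
      a + (if i = r then 1 else 0) + (if i = c' then 1 else 0) := by
  rcases h with ⟨h1, rfl, rfl⟩ | ⟨rfl, rfl, rfl⟩ | ⟨rfl, rfl, rfl, h4⟩ <;> omega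

set_option maxHeartbeats 1000000 in
lemma commute {x P P' c} (hP : Val P) (hP' : Val P') (h : JRel x P P' c) (y : ℕ) :
    ∃ c', JRel x (ins P y) (ins P' y) c' ∧
      ∀ k, x < k → y < k → Sq (P k) (c k) (rr P y k) (rr P' y k) (c' k) := by
  set c' : ℕ → ℕ := fun k => if x < k ∧ y < k ∧ rr P y k = c k then rr P' y k else c k with hc'
  have key : ∀ k, x ≤ k → 
      (y < k + 1 → Sq (P (k+1)) (c (k+1)) (rr P y (k+1)) (rr P' y (k+1)) (c' (k+1))) ∧
      c' (k+1) ≤ c' k ∧ ∀ i, c' (k+1) ≤ i → i < c' k → ins P y (k+1) (i+1) = ins P y k i := by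
    intro k hk
    induction k, hk using Nat.le_induction with
    | base =>
      have hcx : c' x = x := by simp [hc', h.cx]
      rw [hcx]
      have hm := h.mono x le_rfl
      have he := h.eq x
      rw [h.cx] at hm he
      rcases lt_trichotomy y x with hy | hy | hy
      · have := step_x (P x) (P (x+1)) x (c (x+1)) (rr P y x) (rr P y (x+1)) (rr P' y (x+1)) (c' (x+1))
          (hP.up x) hm (fun i => he i le_rfl) (rr_lt _ _ _ hy) (rr_add hP y x hy)
          (by have := rr_succ P y x hy; omega)
          (by have := rr_succ P' y x hy
              rw [rr_congr h.le y x le_rfl, h.le _ _ le_rfl, h.gt _ _ (by omega)] at this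
              omega)
          (by simp only [hc']; grind)
        refine ⟨fun _ => this.1, this.2.1, fun i hi hi' => ?_⟩
        rw [ins_gt _ _ _ _ (by omega), ins_gt _ _ _ _ (by omega)]
        exact this.2.2 i hi hi'
      · subst hy
        have e : c' (y+1) = c (y+1) := by
          simp only [hc', rr_base _ _ _ (le_refl (y+1))]; grind
        rw [e, rr_base _ _ _ (le_refl (y+1)), rr_base _ _ _ (le_refl (y+1))]
        refine ⟨fun _ => by unfold Sq; omega, hm, fun i hi hi' => ?_⟩
        rw [ins_gt _ _ _ _ (by omega), ins_le _ _ _ _ (by omega), rr_base _ _ _ (le_refl (y+1))]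
        simpa using he i le_rfl hi hi'
      · have e : c' (x+1) = c (x+1) := by
          simp only [hc']; grind
        rw [e]
        refine ⟨fun _ => by omega, hm, fun i hi hi' => ?_⟩
        rw [ins_le _ _ _ _ (by omega), ins_le _ _ _ _ (by omega)]
        exact he i le_rfl hi hi'
    | succ k hk ih =>
      have hm := h.mono (k+1) (by omega)
      have he := h.eq (k+1)
      rcases lt_trichotomy y (k+1) with hy | hy | hy
      · have := step_gen (P (k+1)) (P (k+1+1)) (c (k+1)) (c (k+1+1)) (rr P y (k+1)) (rr P' y (k+1))
          (c' (k+1)) (rr P y (k+1+1)) (rr P' y (k+1+1)) (c' (k+1+1))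
          (hP.up _) (hP.dn _) hm (fun i => he i (by omega)) (rr_add hP y _ hy)
          (by have := rr_add hP' y _ hy
              intro j hj
              have := this j hj
              rw [h.gt _ _ (by omega), h.gt _ _ (by omega)] at this
              exact this)
          (by have := rr_succ P y _ hy; omega)
          (by have := rr_succ P' y _ hy
              rw [h.gt _ _ (by omega), h.gt _ _ (by omega)] at this
              omega)
          (by simp only [hc']; grind) (ih.1 hy)
        refine ⟨fun _ => this.1, this.2.1, fun i hi hi' => ?_⟩
        rw [ins_gt _ _ _ _ (by omega), ins_gt _ _ _ _ (by omega)]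
        exact this.2.2 i hi hi'
      · subst hy
        have e : c' (k+1+1) = c (k+1+1) := by
          simp only [hc', rr_base _ _ _ (le_refl (k+1+1))]; grind
        have e2 : c' (k+1) = c (k+1) := by
          simp only [hc']; grind
        rw [e, e2, rr_base _ _ _ (le_refl (k+1+1)), rr_base _ _ _ (le_refl (k+1+1))]
        refine ⟨fun _ => by unfold Sq; omega, hm, fun i hi hi' => ?_⟩
        rw [ins_gt _ _ _ _ (by omega), ins_le _ _ _ _ (by omega), rr_base _ _ _ (le_refl (k+1+1))]
        simpa using he i (by omega) hi hi'
      · have e : c' (k+1+1) = c (k+1+1) := by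
          simp only [hc']; grind
        have e2 : c' (k+1) = c (k+1) := by
          simp only [hc']; grind
        rw [e, e2]
        refine ⟨fun _ => by omega, hm, fun i hi hi' => ?_⟩
        rw [ins_le _ _ _ _ (by omega), ins_le _ _ _ _ (by omega)]
        exact he i (by omega) hi hi'
  have key2 : ∀ k, x < k → y < k → Sq (P k) (c k) (rr P y k) (rr P' y k) (c' k) := by
    intro k hx hy
    obtain ⟨j, rfl⟩ : ∃ j, k = j+1 := ⟨k-1, by omega⟩
    exact (key j (by omega)).1 hy
  refine ⟨c', ⟨?_, ?_, ?_, fun k hk => (key k hk).2.1, fun k i hk => (key k hk).2.2 i⟩, key2⟩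
  · simp [hc', h.cx]
  · intro k i hk
    unfold ins
    rw [rr_congr h.le y k hk, h.le k i hk]
  · intro k i hk
    by_cases hy : y < k
    · have := key2 k hk hy
      rw [ins_gt _ _ _ _ hy, ins_gt _ _ _ _ hy, h.gt _ _ hk]
      exact sq_sum this _ i
    · rw [ins_le _ _ _ _ (by omega), ins_le _ _ _ _ (by omega), h.gt _ _ hk]
      have e : c' k = c k := by
        simp only [hc']; rw [if_neg (by omega)]
      rw [e]

/-- Pattern after inserting the first `t` letters of `w`. -/
def Pat (w : ℕ → ℕ) : ℕ → ℕ → ℕ → ℕ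
  | 0 => fun _ _ => 0
  | t+1 => ins (Pat w t) (w t)

lemma Pat_val (w t) : Val (Pat w t) := by
  induction t with
  | zero => constructor <;> simp [Pat]
  | succ t ih => exact ins_val ih _

lemma Pat_congr (w w' : ℕ → ℕ) (t) (h : ∀ s < t, w s = w' s) : Pat w t = Pat w' t := by
  induction t with
  | zero => rfl
  | succ t ih =>
    rw [Pat, Pat, ih (fun s hs => h s (by omega)), h t (by omega)]

lemma rr_zero (y k) : rr (fun _ _ => 0) y k = 0 := by
  induction k with
  | zero => rfl
  | succ k ih => simp [rr, ih]

lemma Pat_rel (w : ℕ → ℕ) : ∃ c : ℕ → ℕ → ℕ, (∀ k, w 0 < k → c 0 k = 0) ∧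
    (∀ t, JRel (w 0) (Pat (fun s => w (s+1)) t) (Pat w (t+1)) (c t)) ∧
    ∀ t k, w 0 < k → w (t+1) < k → Sq (Pat (fun s => w (s+1)) t k) (c t k)
      (rr (Pat (fun s => w (s+1)) t) (w (t+1)) k) (rr (Pat w (t+1)) (w (t+1)) k) (c (t+1) k) := by
  let A := fun t => {c : ℕ → ℕ // JRel (w 0) (Pat (fun s => w (s+1)) t) (Pat w (t+1)) c}
  have h0 : JRel (w 0) (Pat (fun s => w (s+1)) 0) (Pat w (0+1)) (fun k => if k = w 0 then w 0 else 0) := by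
    constructor
    · simp
    · intro k i hk
      simp only [Pat]; rw [ins_le _ _ _ _ hk]
    · intro k i hk
      simp only [Pat]; rw [ins_gt _ _ _ _ hk, rr_zero, if_neg (show ¬ k = w 0 by omega)]
    · intro k hk
      show (if k+1 = w 0 then w 0 else 0) ≤ _
      rw [if_neg (by omega)]; exact Nat.zero_le _
    · intro k i _ _ _; rfl
  have st : ∀ t (c : A t), ∃ c' : A (t+1), ∀ k, w 0 < k → w (t+1) < k → Sq (Pat (fun s => w (s+1)) t k) (c.1 k)
      (rr (Pat (fun s => w (s+1)) t) (w (t+1)) k) (rr (Pat w (t+1)) (w (t+1)) k) (c'.1 k) := by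
    intro t c
    obtain ⟨c', h1, h2⟩ := commute (Pat_val _ _) (Pat_val _ _) c.2 (w (t+1))
    exact ⟨⟨c', h1⟩, h2⟩
  choose f hf using st
  let C : ∀ t, A t := fun t => Nat.rec (motive := A) ⟨_, h0⟩ (fun t c => f t c) t
  refine ⟨fun t => (C t).1, ?_, fun t => (C t).2, fun t => hf t (C t)⟩
  intro k hk
  show (if k = w 0 then w 0 else 0) = 0
  rw [if_neg (by omega)]

/-- A growing sequence of partitions with `l` rows, all unbounded. -/
structure Growth (l : ℕ) (S : ℕ → ℕ → ℕ) (ρ : ℕ → ℕ) : Prop where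
  zero : ∀ i, S 0 i = 0
  succ : ∀ t i, S (t+1) i = S t i + if i = ρ t then 1 else 0
  lt : ∀ t, ρ t < l
  anti : ∀ t i, S t (i+1) ≤ S t i
  unb : ∀ i, i < l → ∀ N, ∃ t, N < S t i

/-- The tableau of a growth. -/
noncomputable def tab (l : ℕ) (S : ℕ → ℕ → ℕ) : ℕ × ℕ → ℕ := fun b =>
  if b.1 < l then sInf {t | b.2 < S t b.1} else 0

lemma box_iff (l : ℕ) (b : ℕ × ℕ) : Box (l : ℕ∞) b ↔ b.1 < l := by
  unfold Box; exact_mod_cast Iff.rfl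

section
variable {l : ℕ} {S : ℕ → ℕ → ℕ} {ρ : ℕ → ℕ}

lemma Growth.mono (h : Growth l S ρ) (i : ℕ) {s t : ℕ} (hst : s ≤ t) : S s i ≤ S t i := by
  induction t, hst using Nat.le_induction with
  | base => exact le_rfl
  | succ t _ ih => rw [h.succ]; omega

lemma Growth.out (h : Growth l S ρ) (i : ℕ) (hi : l ≤ i) (t : ℕ) : S t i = 0 := by
  induction t with
  | zero => exact h.zero i
  | succ t ih =>
    have := h.lt t
    rw [h.succ, ih, if_neg (by omega)]

lemma Growth.tab_le (h : Growth l S ρ) {i j t : ℕ} (hi : i < l) : tab l S (i,j) ≤ t ↔ j < S t i := by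
  unfold tab
  simp only [hi, if_true]
  constructor
  · intro ht
    have hne : {t | j < S t i}.Nonempty := h.unb i hi j
    have : j < S (sInf {t | j < S t i}) i := Nat.sInf_mem hne
    exact lt_of_lt_of_le this (h.mono i ht)
  · intro ht
    exact Nat.sInf_le ht

lemma Growth.tab_eq (h : Growth l S ρ) {i j t : ℕ} (hi : i < l) :
    tab l S (i,j) = t+1 ↔ S t i = j ∧ ρ t = i := by
  have h1 := h.tab_le (j := j) (t := t) hi
  have h2 := h.tab_le (j := j) (t := t+1) hi
  rw [h.succ] at h2
  constructor
  · intro e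
    rw [e] at h1 h2
    by_cases hh : i = ρ t
    · rw [if_pos hh] at h2; omega
    · rw [if_neg hh] at h2; omega
  · rintro ⟨e1, e2⟩
    rw [if_pos e2.symm] at h2
    omega

lemma Growth.tab_pos (h : Growth l S ρ) {i j : ℕ} (hi : i < l) : ∃ t, tab l S (i,j) = t+1 := by
  have h1 := h.tab_le (j := j) (t := 0) hi
  rw [h.zero] at h1
  exact ⟨tab l S (i,j) - 1, by omega⟩

lemma Growth.isSYT (h : Growth l S ρ) : IsSYT (l : ℕ∞) (tab l S) := by
  constructor
  · intro b hb
    rw [box_iff] at hb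
    unfold tab; rw [if_neg hb]
  · rintro ⟨i, j⟩ hb
    rw [box_iff] at hb
    obtain ⟨t, ht⟩ := h.tab_pos (j := j) hb
    rw [ht]; omega
  · rintro ⟨i, j⟩ ⟨i', j'⟩ hb hc e
    rw [box_iff] at hb hc
    simp only at hb hc
    obtain ⟨t, ht⟩ := h.tab_pos (j := j) hb
    rw [ht] at e
    have e := e.symm
    rw [h.tab_eq hb] at ht
    rw [h.tab_eq hc] at e
    obtain ⟨rfl, rfl⟩ := ht
    obtain ⟨e1, e2⟩ := e
    simp only [Prod.mk.injEq]
    exact ⟨e2, by rw [← e1, ← e2]⟩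
  · intro n hn
    refine ⟨(ρ (n-1), S (n-1) (ρ (n-1))), ?_, ?_⟩
    · rw [box_iff]; exact h.lt _
    · obtain ⟨m, rfl⟩ : ∃ m, n = m+1 := ⟨n-1, by omega⟩
      rw [h.tab_eq (h.lt _)]
      simp
  · rintro ⟨i, j⟩ hb
    rw [box_iff] at hb
    simp only at hb ⊢
    obtain ⟨t, ht⟩ := h.tab_pos (j := j+1) hb
    rw [ht]
    rw [h.tab_eq hb] at ht
    have := (h.tab_le (j := j) (t := t) hb).2 (by omega)
    omega
  · rintro ⟨i, j⟩ hb
    rw [box_iff] at hb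
    simp only at hb ⊢
    obtain ⟨t, ht⟩ := h.tab_pos (j := j) hb
    rw [ht]
    rw [h.tab_eq hb] at ht
    have h1 := h.anti (t+1) i
    rw [h.succ, h.succ, if_pos (by omega), if_neg (by omega)] at h1
    have := (h.tab_le (i := i) (j := j) (t := t) (by omega)).2 (by omega)
    omega

lemma jdt_tab {S' : ℕ → ℕ → ℕ} {ρ' c : ℕ → ℕ} (h : Growth l S ρ) (h' : Growth l S' ρ')
    (c0 : c 0 = 0) (hS : ∀ t i, S (t+1) i = S' t i + if i = c t then 1 else 0)
    (hsq : ∀ t, Sq (S' t) (c t) (ρ' t) (ρ (t+1)) (c (t+1))) :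
    jdt (Box (l : ℕ∞)) (tab l S) = tab l S' := by
  have cl : ∀ t, c t < l := by
    intro t
    by_contra hc
    have := hS t (c t)
    rw [h.out _ (by omega)] at this
    simp at this
  -- the next box on the path
  have nxt : ∀ t, ρ' t = c t → 
      tab l S (c (t+1), S' (t+1) (c (t+1))) = t+2 ∧
      slideFrom (Box (l : ℕ∞)) (tab l S) (0,0) (c t + S' t (c t)) = (c t, S' t (c t)) →
      (slideFrom (Box (l : ℕ∞)) (tab l S) (0,0) (c t + S' t (c t) + 1) = (c (t+1), S' (t+1) (c (t+1)))
        ) := by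
    intro t hr ⟨ht, hsl⟩
    have hcl := cl t
    have hcl' := cl (t+1)
    rw [slideFrom]
    simp only [hsl, box_iff]
    have e1 : S' (t+1) (c t) = S' t (c t) + 1 := by rw [h'.succ, if_pos hr.symm]
    have an := h'.anti t (c t)
    rcases hsq t with ⟨q1, q2, q3⟩ | ⟨q1, q2, q3⟩ | ⟨q1, q2, q3, q4⟩
    · exact absurd hr q1
    · rw [q3, e1] at ht ⊢
      by_cases hd : c t + 1 < l
      · have := (h.tab_le (i := c t + 1) (j := S' t (c t)) (t := t+2) hd).not
        rw [h.succ (t+1), hS, q2, if_neg (by omega)] at this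
        rw [if_pos ⟨hd, hcl⟩, if_neg (by omega)]
      · rw [if_neg (by omega), if_neg hd, if_pos hcl]
    · have e2 : S' (t+1) (c (t+1)) = S' t (c t) := by
        rw [h'.succ, if_neg (by omega), q3, q4]; omega
      rw [e2, q3] at ht ⊢
      have := (h.tab_le (i := c t) (j := S' t (c t) + 1) (t := t+2) hcl).not
      rw [h.succ (t+1), hS, q2, if_pos (by omega), if_neg (by omega)] at this
      rw [if_pos ⟨by omega, hcl⟩, if_pos (by omega)]
  have nxtT : ∀ t, ρ' t = c t → tab l S (c (t+1), S' (t+1) (c (t+1))) = t+2 := by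
    intro t hr
    rw [h.tab_eq (cl _), hS]
    rcases hsq t with ⟨q1, q2, q3⟩ | ⟨q1, q2, q3⟩ | ⟨q1, q2, q3, q4⟩
    · exact absurd hr q1
    · rw [h'.succ, q3, q2, if_pos rfl, if_pos q1.symm]; simp
    · rw [h'.succ, q3, q2, if_neg (by omega), if_neg (by omega)]; simp
  have lev : ∀ t, ρ' t = c t → c (t+1) + S' (t+1) (c (t+1)) = c t + S' t (c t) + 1 := by
    intro t hr
    rcases hsq t with ⟨q1, q2, q3⟩ | ⟨q1, q2, q3⟩ | ⟨q1, q2, q3, q4⟩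
    · exact absurd hr q1
    · rw [h'.succ, q3, if_pos q1.symm]; omega
    · rw [h'.succ, q3, if_neg (by omega)]; omega
  have stay : ∀ t, ρ' t ≠ c t → c (t+1) = c t ∧ S' (t+1) (c t) = S' t (c t) := by
    intro t hr
    rcases hsq t with ⟨q1, q2, q3⟩ | ⟨q1, q2, q3⟩ | ⟨q1, q2, q3, q4⟩
    · refine ⟨q3, ?_⟩
      rw [h'.succ, if_neg (by omega)]; omega
    · exact absurd q1 hr
    · exact absurd q1 hr
  have path : ∀ t, slideFrom (Box (l : ℕ∞)) (tab l S) (0,0) (c t + S' t (c t)) = (c t, S' t (c t)) := by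
    intro t
    induction t with
    | zero => rw [c0, h'.zero]; rfl
    | succ t ih =>
      by_cases hr : ρ' t = c t
      · rw [lev t hr]
        exact nxt t hr ⟨nxtT t hr, ih⟩
      · obtain ⟨a, b⟩ := stay t hr
        rw [a, b, ih]
  have reach : ∀ q, ∃ t, c t + S' t (c t) = q := by
    intro q
    induction q with
    | zero => exact ⟨0, by rw [c0, h'.zero]⟩
    | succ q ih =>
      obtain ⟨t, ht⟩ := ih
      by_contra hcon
      push Not at hcon
      have : ∀ m, c (t+m) = c t ∧ S' (t+m) (c t) = S' t (c t) := by
        intro m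
        induction m with
        | zero => simp
        | succ m ihm =>
          by_cases hr : ρ' (t+m) = c (t+m)
          · have := lev _ hr
            rw [ihm.1, ihm.2, ht] at this
            exact absurd this (hcon _)
          · have := stay _ hr
            rw [ihm.1, ihm.2] at this
            exact this
      obtain ⟨s, hs⟩ := h'.unb (c t) (cl t) (S' t (c t))
      have h1 := h'.mono (c t) (show s ≤ t + s by omega)
      have h2 := (this s).2
      omega
  have persist : ∀ s t, t ≤ s → S' s (c t) = S' t (c t) → c s = c t := by
    intro s t hts
    induction s, hts using Nat.le_induction with
    | base => intro _; rfl
    | succ s hs ih =>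
      intro e
      have h1 := h'.mono (c t) hs
      have h2 := h'.mono (c t) (Nat.le_succ s)
      have e2 : S' s (c t) = S' t (c t) := by simp only [Nat.succ_eq_add_one] at h2; omega
      have e3 := ih e2
      by_cases hr : ρ' s = c s
      · have := h'.succ s (c t)
        rw [if_pos (by omega)] at this
        omega
      · rw [(stay s hr).1, e3]
  funext ⟨i, j⟩
  unfold jdt slide
  simp only
  by_cases hi : i < l
  · obtain ⟨s, hs⟩ := h'.tab_pos (j := j) hi
    have hs' := hs
    rw [h'.tab_eq hi] at hs'
    obtain ⟨e1, e2⟩ := hs'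
    by_cases hc : ρ' s = c s
    · have ei : i = c s := by omega
      have p1 := path s
      have p2 := nxt s hc ⟨nxtT s hc, p1⟩
      subst ei
      rw [e1] at p1 p2
      have lv := lev s hc
      rw [p1, if_pos rfl, p2, if_neg, nxtT s hc, hs]
      · rfl
      · intro e
        rw [Prod.mk.injEq] at e
        obtain ⟨e3, e4⟩ := e
        omega
    · rw [if_neg]
      · rw [hs]
        have : tab l S (i,j) = s+1+1 := by
          rw [h.tab_eq hi, hS, if_neg (by omega)]
          rcases hsq s with ⟨q1, q2, q3⟩ | ⟨q1, q2, q3⟩ | ⟨q1, q2, q3, q4⟩ <;> omega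
        omega
      · intro e
        obtain ⟨t, ht⟩ := reach (i+j)
        have p := path t
        rw [ht, e, Prod.mk.injEq] at p
        obtain ⟨p1, p2⟩ := p
        subst p1
        have hts : t ≤ s := by
          by_contra hlt
          have := h'.mono (c t) (show s+1 ≤ t by omega)
          rw [h'.succ, if_pos e2.symm] at this
          omega
        have := persist s t hts (by omega)
        omega
  · rw [if_neg]
    · unfold tab; simp [hi]
    · intro e
      obtain ⟨t, ht⟩ := reach (i+j)
      have p := path t
      rw [ht, e, Prod.mk.injEq] at p
      have := cl t
      omega
end

lemma Pat_mono (w k i) {s t : ℕ} (h : s ≤ t) : Pat w s k i ≤ Pat w t k i := by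
  induction t, h using Nat.le_induction with
  | base => exact le_rfl
  | succ t _ ih =>
    refine ih.trans ?_
    rw [Pat]; unfold ins; split_ifs <;> omega

lemma Pat_unb (w : ℕ → ℕ) (l : ℕ) (hw : ∀ k < l, ∀ N, ∃ t, N ≤ t ∧ w t = k) :
    ∀ k, k ≤ l → ∀ i, i < k → ∀ N, ∃ t, N < Pat w t k i := by
  intro k
  induction k with
  | zero => omega
  | succ k ih =>
    intro hk
    have ih := ih (by omega)
    have INC : ∀ i, i ≤ k → ∀ N, ∃ t, N ≤ t ∧ w t < k+1 ∧ rr (Pat w t) (w t) (k+1) = i ∧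
        Pat w (t+1) k i < Pat w (t+1) (k+1) i := by
      intro i
      induction i with
      | zero =>
        intro _ N
        obtain ⟨t, h1, h2⟩ := hw k (by omega) N
        have hr := rr_base (Pat w t) (w t) (k+1) (by omega)
        refine ⟨t, h1, by omega, hr, ?_⟩
        rw [Pat, ins_le _ _ _ _ (by omega), ins_gt _ _ _ _ (by omega), hr, if_pos rfl]
        have := (Pat_val w t).up k 0
        omega
      | succ i ihi =>
        intro hik N
        obtain ⟨t, h1, h2, h3, h4⟩ := ihi (by omega) N
        obtain ⟨s, hs1, hs2, hs3, hs4⟩ : ∃ s, t+1 ≤ s ∧ w s < k ∧ rr (Pat w s) (w s) k = i ∧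
            Pat w s k i < Pat w s (k+1) i := by
          by_contra hcon
          push Not at hcon
          have : ∀ m, Pat w (t+1+m) k i = Pat w (t+1) k i := by
            intro m
            induction m with
            | zero => rfl
            | succ m ihm =>
              rw [← ihm, ← add_assoc]
              have h5 := hcon (t+1+m) (by omega)
              have h6 := Pat_mono w (k+1) i (show t+1 ≤ t+1+m by omega)
              rw [Pat]; unfold ins
              rw [if_neg]
              rintro ⟨h7, h8⟩
              have := h5 h7 h8.symm
              omega
          obtain ⟨s, hs⟩ := ih i (by omega) (Pat w (t+1) k i)
          have h5 := this s
          have h6 := Pat_mono w k i (show s ≤ t+1+s by omega)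
          omega
        have hr := rr_succ (Pat w s) (w s) k hs2
        rw [hs3] at hr
        have hr' : rr (Pat w s) (w s) (k+1) = i+1 := by omega
        refine ⟨s, by omega, by omega, hr', ?_⟩
        rw [Pat, ins_gt _ _ _ _ (by omega), ins_gt _ _ _ _ (by omega), hr', hs3, if_pos rfl, if_neg (by omega)]
        have := (Pat_val w s).up k (i+1)
        omega
    intro i hi N
    by_cases hik : i < k
    · obtain ⟨t, ht⟩ := ih i hik N
      exact ⟨t, lt_of_lt_of_le ht ((Pat_val w t).up k i)⟩
    · have : i = k := by omega
      subst this
      induction N with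
      | zero =>
        obtain ⟨t, h1, h2, h3, h4⟩ := INC i le_rfl 0
        exact ⟨t+1, by omega⟩
      | succ N ihN =>
        obtain ⟨s, hs⟩ := ihN
        obtain ⟨t, h1, h2, h3, h4⟩ := INC i le_rfl s
        refine ⟨t+1, ?_⟩
        rw [Pat, ins_gt _ _ _ _ h2, h3, if_pos rfl]
        have := Pat_mono w (i+1) i h1
        omega

lemma Pat_missing (w : ℕ → ℕ) (k t : ℕ) (h : ∀ s < t, w s ≠ k) (i : ℕ) :
    Pat w t (k+1) i = Pat w t k i := by
  induction t generalizing i with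
  | zero => rfl
  | succ t ih =>
    have ih := ih (fun s hs => h s (by omega))
    have := h t (by omega)
    rw [Pat]
    by_cases hk : w t < k
    · rw [ins_gt _ _ _ _ hk, ins_gt _ _ _ _ (by omega), ih]
      have := rr_succ (Pat w t) (w t) k hk
      rw [ih] at this
      have : rr (Pat w t) (w t) (k+1) = rr (Pat w t) (w t) k := by omega
      rw [this]
    · rw [ins_le _ _ _ _ (by omega), ins_le _ _ _ _ (by omega), ih]

lemma rev_path {G} (hG : Val G) : ∀ k r, G k (r+1) < G k r → ∃ y, ∃ p : ℕ → ℕ, y < k ∧ p k = r ∧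
    p (y+1) = 0 ∧ G y 0 < G (y+1) 0 ∧ (∀ m, y < m → m ≤ k → G m (p m + 1) < G m (p m)) ∧
    ∀ m, y < m → m < k → (p (m+1) = p m ∧ G (m+1) (p m) = G m (p m)) ∨
      (p (m+1) = p m + 1 ∧ G m (p m + 1) < G (m+1) (p m + 1)) := by
  intro k
  induction k with
  | zero => intro r h; rw [hG.z, hG.z] at h; omega
  | succ k ih =>
    intro r h
    -- extension of a path
    have ext : ∀ r0, G k (r0+1) < G k r0 → ((r = r0 ∧ G (k+1) r0 = G k r0) ∨
        (r = r0+1 ∧ G k (r0+1) < G (k+1) (r0+1))) → ∃ y, ∃ p : ℕ → ℕ, y < k+1 ∧ p (k+1) = r ∧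
    p (y+1) = 0 ∧ G y 0 < G (y+1) 0 ∧ (∀ m, y < m → m ≤ k+1 → G m (p m + 1) < G m (p m)) ∧
    ∀ m, y < m → m < k+1 → (p (m+1) = p m ∧ G (m+1) (p m) = G m (p m)) ∨
      (p (m+1) = p m + 1 ∧ G m (p m + 1) < G (m+1) (p m + 1)) := by
      intro r0 h0 hor
      obtain ⟨y, p, h1, h2, h3, h4, h5, h6⟩ := ih r0 h0
      have e : ∀ m, m ≤ k → (if m = k+1 then r else p m) = p m := by
        intro m hm; rw [if_neg (by omega)]
      refine ⟨y, fun m => if m = k+1 then r else p m, by omega, by simp, ?_, h4, ?_, ?_⟩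
      · simp only [e (y+1) (by omega)]; exact h3
      · intro m hm1 hm2
        by_cases hm : m ≤ k
        · simp only [e m hm]; exact h5 m hm1 hm
        · have : m = k+1 := by omega
          subst this
          simpa using h
      · intro m hm1 hm2
        by_cases hm : m < k
        · simp only [e m (by omega), e (m+1) (by omega)]; exact h6 m hm1 hm
        · have : m = k := by omega
          subst this
          simp only [e m le_rfl, if_true]; rw [h2]
          exact hor
    by_cases he : G (k+1) r = G k r
    · apply ext r _ (Or.inl ⟨rfl, he⟩)
      have := hG.up k (r+1)
      omega
    · have hlt := lt_of_le_of_ne (hG.up k r) (Ne.symm he)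
      cases r with
      | zero =>
        refine ⟨k, fun _ => 0, by omega, rfl, rfl, hlt, ?_, ?_⟩
        · intro m h1 h2
          have : m = k+1 := by omega
          subst this; exact h
        · intro m h1 h2; omega
      | succ r0 =>
        apply ext r0 _ (Or.inr ⟨rfl, hlt⟩)
        have := hG.dn k r0
        omega

lemma rev_ins {G : ℕ → ℕ → ℕ} {Λ : ℕ → ℕ} {l : ℕ} (hG : Val G) (hl : ∀ k, l ≤ k → G k = Λ) (r : ℕ)
    (hr : Λ (r+1) < Λ r) : ∃ y g, y < l ∧ Val g ∧ ins g y = G ∧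
      ∀ k, l ≤ k → ∀ i, g k i = Λ i - if i = r then 1 else 0 := by
  obtain ⟨y, p0, h1, h2, h3, h4, h5, h6⟩ := rev_path hG l r (by rw [hl l le_rfl]; exact hr)
  obtain ⟨p, hp⟩ : ∃ p : ℕ → ℕ, p = fun m => if m ≤ l then p0 m else r := ⟨_, rfl⟩
  have pl : ∀ m, l ≤ m → p m = r := by
    intro m hm
    rw [hp]
    by_cases h : m = l
    · subst h; simpa using h2
    · beta_reduce; rw [if_neg (by omega)]
  have pe : ∀ m, m ≤ l → p m = p0 m := by
    intro m hm; rw [hp]; simp [hm]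
  have q3 : p (y+1) = 0 := by rw [pe _ (by omega), h3]
  have q5 : ∀ m, y < m → G m (p m + 1) < G m (p m) := by
    intro m hm
    by_cases h : m ≤ l
    · rw [pe m h]; exact h5 m hm h
    · rw [pl m (by omega), hl m (by omega)]; exact hr
  have q6 : ∀ m, y < m → (p (m+1) = p m ∧ G (m+1) (p m) = G m (p m)) ∨
      (p (m+1) = p m + 1 ∧ G m (p m + 1) < G (m+1) (p m + 1)) := by
    intro m hm
    by_cases h : m < l
    · rw [pe m (by omega), pe (m+1) (by omega)]; exact h6 m hm h
    · left
      rw [pl m (by omega), pl (m+1) (by omega), hl m (by omega), hl (m+1) (by omega)]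
      exact ⟨rfl, rfl⟩
  obtain ⟨g, hg⟩ : ∃ g : ℕ → ℕ → ℕ, g = fun m i => G m i - if y < m ∧ i = p m then 1 else 0 := ⟨_, rfl⟩
  have g1 : ∀ m i, m ≤ y → g m i = G m i := by
    intro m i hm; rw [hg]; beta_reduce; rw [if_neg (by omega)]; omega
  have g2 : ∀ m i, y < m → g m i = G m i - if i = p m then 1 else 0 := by
    intro m i hm; rw [hg]; simp [hm]
  have hrr : ∀ m, y < m → rr g y m = p m := by
    intro m hm
    induction m, hm using Nat.le_induction with
    | base => rw [rr_base _ _ _ le_rfl, q3]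
    | succ m hm ih =>
      have hm : y < m := hm
      have a := rr_succ g y m hm
      rw [ih] at a
      rw [g2 _ _ hm, g2 _ _ (by omega), if_pos rfl] at a
      have b := q5 m hm
      have d := hG.up m (p m)
      rcases q6 m hm with ⟨e1, e2⟩ | ⟨e1, e2⟩
      · rw [if_pos e1.symm] at a; omega
      · rw [if_neg (by omega)] at a; omega
  refine ⟨y, g, h1, ⟨?_, ?_, ?_⟩, ?_, ?_⟩
  · intro i; rw [g1 _ _ (by omega)]; exact hG.z i
  · intro k i
    have d := hG.up k i
    rcases lt_trichotomy k y with hk | hk | hk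
    · rw [g1 _ _ (by omega), g1 _ _ (by omega)]; exact d
    · subst hk
      rw [g1 _ _ (by omega), g2 _ _ (by omega), q3]
      split_ifs with hi
      · subst hi; omega
      · omega
    · rw [g2 _ _ (by omega), g2 _ _ (by omega)]
      by_cases hi : i = p (k+1)
      · rcases q6 k hk with ⟨e1, e2⟩ | ⟨e1, e2⟩
        · rw [if_pos (by omega), if_pos hi]; omega
        · rw [e1] at hi; subst hi
          rw [if_neg (by omega), if_pos e1.symm]; omega
      · rw [if_neg hi]; omega
  · intro k i
    have d := hG.dn k i
    by_cases hk : k ≤ y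
    · rw [g1 _ _ hk]
      refine le_trans ?_ d
      rw [hg]; exact Nat.sub_le _ _
    · rw [g2 _ _ (by omega), g2 _ _ (by omega)]
      by_cases hi : i = p k
      · subst hi
        rcases q6 k (by omega) with ⟨e1, e2⟩ | ⟨e1, e2⟩
        · have := q5 (k+1) (by omega)
          rw [e1] at this
          rw [if_pos rfl]; omega
        · rw [if_pos rfl, if_pos e1.symm]; omega
      · rw [if_neg hi]; omega
  · funext m i
    by_cases hm : m ≤ y
    · rw [ins_le _ _ _ _ hm, g1 _ _ hm]
    · rw [ins_gt _ _ _ _ (by omega), hrr m (by omega), g2 _ _ (by omega)]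
      have := q5 m (by omega)
      split_ifs with hi
      · subst hi; omega
      · omega
  · intro k hk i
    rw [g2 _ _ (by omega), hl k hk, pl k hk]

lemma rev_word {Λ : ℕ → ℕ → ℕ} {l : ℕ} (n : ℕ) (h0 : ∀ i, Λ 0 i = 0)
    (hanti : ∀ t i, Λ t (i+1) ≤ Λ t i)
    (hs : ∀ t, t < n → ∃ r, ∀ i, Λ (t+1) i = Λ t i + if i = r then 1 else 0) :
    ∀ t, t ≤ n → ∀ G, Val G → (∀ k, l ≤ k → G k = Λ t) →
      ∃ w : ℕ → ℕ, (∀ s < t, w s < l) ∧ Pat w t = G ∧ ∀ s ≤ t, Pat w s l = Λ s := by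
  intro t
  induction t with
  | zero =>
    intro _ G hG hl
    have hz : ∀ m k i, k + m = l → G k i = 0 := by
      intro m
      induction m with
      | zero => intro k i hk; rw [hl k (by omega), h0]
      | succ m ih =>
        intro k i hk
        have := hG.up k i
        have := ih (k+1) i (by omega)
        omega
    refine ⟨fun _ => 0, by omega, ?_, ?_⟩
    · funext k i
      simp only [Pat]
      by_cases hk : k ≤ l
      · exact (hz (l-k) k i (by omega)).symm
      · rw [hl k (by omega), h0]
    · intro s hs
      have : s = 0 := by omega
      subst this
      funext i; simp [Pat, h0]
  | succ t ih =>
    intro htn G hG hl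
    obtain ⟨r, hr⟩ := hs t (by omega)
    obtain ⟨y, g, h1, h2, h3, h4⟩ := rev_ins hG hl r (by
      have := hanti t r
      rw [hr, hr, if_pos rfl, if_neg (by omega)]; omega)
    obtain ⟨w, w1, w2, w3⟩ := ih (by omega) g h2 (by
      intro k hk; funext i
      rw [h4 k hk, hr]; omega)
    have e : ∀ s < t, (if s = t then y else w s) = w s := by
      intro s hs; rw [if_neg (by omega)]
    have hc : ∀ s ≤ t, Pat (fun s => if s = t then y else w s) s = Pat w s := by
      intro s hs
      exact Pat_congr _ _ _ (fun a ha => e a (by omega))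
    have hc' : Pat (fun s => if s = t then y else w s) (t+1) = G := by
      rw [Pat, hc t le_rfl, w2]; simpa using h3
    refine ⟨fun s => if s = t then y else w s, ?_, hc', ?_⟩
    · intro s hs
      by_cases h : s = t
      · simpa [h] using h1
      · simpa [h] using w1 s (by omega)
    · intro s hs
      by_cases h : s = t+1
      · subst h; rw [hc', hl l le_rfl]
      · rw [hc s (by omega), w3 s (by omega)]

lemma exists_pat : ∀ (l : ℕ) (lam : ℕ → ℕ), (∀ i, lam (i+1) ≤ lam i) → (∀ i, l ≤ i → lam i = 0) →
    l ≤ ∑ i ∈ Finset.range l, lam i →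
    ∃ G, Val G ∧ (∀ k, l ≤ k → G k = lam) ∧ ∀ k < l, ∃ i, G k i < G (k+1) i := by
  intro l
  induction l with
  | zero =>
    intro lam h1 h2 _
    refine ⟨fun _ _ => 0, ⟨by simp, by simp, by simp⟩, ?_, by omega⟩
    intro k _; funext i; exact (h2 i (by omega)).symm
  | succ l ih =>
    intro lam h1 h2 h3
    have main : ∀ lam' : ℕ → ℕ, (∀ i, lam' i ≤ lam i) → (∀ i, lam (i+1) ≤ lam' i) →
        (∃ i, lam' i < lam i) → (∀ i, l ≤ i → lam' i = 0) → l ≤ ∑ i ∈ Finset.range l, lam' i →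
        ∃ G, Val G ∧ (∀ k, l+1 ≤ k → G k = lam) ∧ ∀ k < l+1, ∃ i, G k i < G (k+1) i := by
      intro lam' a1 a2 a3 a4 a5
      obtain ⟨G, g1, g2, g3⟩ := ih lam' (fun i => (a1 _).trans (a2 i)) a4 a5
      have e1 : ∀ k, k ≤ l → (if k ≤ l then G k else lam) = G k := fun k hk => if_pos hk
      have e2 : ∀ k, l < k → (if k ≤ l then G k else lam) = lam := fun k hk => if_neg (by omega)
      refine ⟨fun k => if k ≤ l then G k else lam, ⟨?_, ?_, ?_⟩, ?_, ?_⟩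
      · intro i; simpa using g1.z i
      · intro k i
        beta_reduce
        rcases lt_trichotomy k l with hk | hk | hk
        · rw [e1 k (by omega), e1 (k+1) (by omega)]; exact g1.up k i
        · rw [e1 k (by omega), e2 (k+1) (by omega), g2 k (by omega)]; exact a1 i
        · rw [e2 k (by omega), e2 (k+1) (by omega)]
      · intro k i
        beta_reduce
        rcases lt_trichotomy k l with hk | hk | hk
        · rw [e1 k (by omega), e1 (k+1) (by omega)]; exact g1.dn k i
        · rw [e1 k (by omega), e2 (k+1) (by omega), g2 k (by omega)]; exact a2 i
        · rw [e2 k (by omega), e2 (k+1) (by omega)]; exact h1 i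
      · intro k hk; exact e2 k (by omega)
      · intro k hk
        beta_reduce
        by_cases hk' : k < l
        · rw [e1 k (by omega), e1 (k+1) (by omega)]; exact g3 k hk'
        · rw [e1 k (by omega), e2 (k+1) (by omega), g2 k (by omega)]; exact a3
    have hant : Antitone lam := antitone_nat_of_succ_le h1
    by_cases hl : lam l = 0
    · rw [Finset.sum_range_succ, hl] at h3
      have hex : ∃ m, lam m = 0 := ⟨l, hl⟩
      obtain ⟨m, hm⟩ : ∃ m, m = Nat.find hex := ⟨_, rfl⟩
      have hm0 : lam m = 0 := hm ▸ Nat.find_spec hex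
      have hml : m ≤ l := hm ▸ Nat.find_min' hex hl
      have hmp : ∀ i < m, lam i ≠ 0 := fun i hi => Nat.find_min hex (hm ▸ hi)
      have hmpos : 0 < m := by
        by_contra h
        have hm' : m = 0 := by omega
        rw [hm'] at hm0
        have : ∑ i ∈ Finset.range l, lam i = 0 := by
          apply Finset.sum_eq_zero
          intro i _
          have := hant (Nat.zero_le i)
          omega
        omega
      obtain ⟨a, rfl⟩ : ∃ a, m = a+1 := ⟨m-1, by omega⟩
      have hap := hmp a (by omega)
      apply main (fun i => lam i - if i = a then 1 else 0)
      · intro i; exact Nat.sub_le _ _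
      · intro i
        have := h1 i
        by_cases hi : i = a
        · subst hi; rw [hm0]; exact Nat.zero_le _
        · simp only [if_neg hi]; omega
      · exact ⟨a, by simp; omega⟩
      · intro i hi
        have := hant hi
        beta_reduce; omega
      · have : ∑ i ∈ Finset.range l, lam i = ∑ i ∈ Finset.range l, (lam i - if i = a then 1 else 0) + 1 := by
          rw [← Finset.add_sum_erase _ _ (Finset.mem_range.2 (show a < l by omega)),
            ← Finset.add_sum_erase _ (fun i => lam i - if i = a then 1 else 0) (Finset.mem_range.2 (show a < l by omega))]
          have : ∑ x ∈ (Finset.range l).erase a, lam x =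
              ∑ x ∈ (Finset.range l).erase a, (lam x - if x = a then 1 else 0) := by
            apply Finset.sum_congr rfl
            intro i hi
            rw [if_neg (Finset.ne_of_mem_erase hi)]; omega
          rw [← this]; simp only [if_true]; omega
        omega
    · apply main (fun i => lam (i+1))
      · exact h1
      · intro i; exact le_rfl
      · exact ⟨l, by beta_reduce; rw [h2 (l+1) le_rfl]; omega⟩
      · intro i hi; exact h2 _ (by omega)
      · calc l = ∑ i ∈ Finset.range l, 1 := by simp
          _ ≤ _ := by
            apply Finset.sum_le_sum
            intro i hi
            have := hant (show i+1 ≤ l by simpa [Nat.succ_le_iff] using hi)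
            omega

lemma growth_Pat (w : ℕ → ℕ) (l : ℕ) (hwl : ∀ t, w t < l) (hw : ∀ k < l, ∀ N, ∃ t, N ≤ t ∧ w t = k) :
    Growth l (fun t => Pat w t l) (fun t => rr (Pat w t) (w t) l) where
  zero _ := rfl
  succ t i := ins_gt _ _ _ _ (hwl t)
  lt t := rr_lt _ _ _ (hwl t)
  anti t i := (Pat_val w t).anti l i
  unb i hi N := Pat_unb w l hw l le_rfl i hi N

lemma jdt_word (w : ℕ → ℕ) (l : ℕ) (hwl : ∀ t, w t < l) (hw : ∀ k < l, ∀ N, ∃ t, N ≤ t ∧ w t = k) :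
    jdt (Box (l : ℕ∞)) (tab l (fun t => Pat w t l)) =
      tab l (fun t => Pat (fun s => w (s+1)) t l) := by
  obtain ⟨c, h1, h2, h3⟩ := Pat_rel w
  refine jdt_tab (growth_Pat w l hwl hw) (growth_Pat (fun s => w (s+1)) l (fun t => hwl _) ?_)
    (c := fun t => c t l) (h1 l (hwl 0)) (fun t i => (h2 t).gt l i (hwl 0))
    (fun t => h3 t l (hwl 0) (hwl _))
  intro k hk N
  obtain ⟨t, ht, ht'⟩ := hw k hk (N+1)
  exact ⟨t-1, by omega, by beta_reduce; rw [Nat.sub_add_cancel (by omega)]; exact ht'⟩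

lemma jdt_iter (w : ℕ → ℕ) (l : ℕ) (hwl : ∀ t, w t < l) (hw : ∀ k < l, ∀ N, ∃ t, N ≤ t ∧ w t = k)
    (m : ℕ) : (jdt (Box (l : ℕ∞)))^[m] (tab l (fun t => Pat w t l)) =
      tab l (fun t => Pat (fun s => w (s+m)) t l) := by
  induction m with
  | zero => rfl
  | succ m ih =>
    rw [Function.iterate_succ_apply', ih, jdt_word (fun s => w (s+m)) l (fun t => hwl _)]
    · have : (fun s => w (s+1+m)) = fun s => w (s+(m+1)) := by
        funext s; congr 1; omega
      simp only [this]
    · intro k hk N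
      obtain ⟨t, ht, ht'⟩ := hw k hk (N+m)
      exact ⟨t-m, by omega, by beta_reduce; rw [Nat.sub_add_cancel (by omega)]; exact ht'⟩

lemma sum_ge (n l : ℕ) (lam : ℕ → ℕ) (hpart : IsPartition lam n) (hrows : ∀ i : ℕ, l ≤ i → lam i = 0) :
    n ≤ ∑ i ∈ Finset.range l, lam i := by
  rw [← hpart.card]
  have : {b : ℕ × ℕ | YBox lam b} ⊆
      (((Finset.range l).biUnion fun i => (Finset.range (lam i)).image fun j => (i, j) : Finset (ℕ × ℕ)) : Set (ℕ × ℕ)) := by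
    rintro ⟨i, j⟩ hb
    have hb : j < lam i := hb
    simp only [Finset.coe_biUnion, Set.mem_iUnion, Finset.mem_coe, Finset.mem_range, Finset.mem_image]
    refine ⟨i, ?_, j, hb, rfl⟩
    by_contra h
    rw [hrows i (by omega)] at hb; omega
  refine (Set.ncard_le_ncard this (Finset.finite_toSet _)).trans ?_
  rw [Set.ncard_coe_finset]
  refine Finset.card_biUnion_le.trans ?_
  apply Finset.sum_le_sum
  intro i _
  exact Finset.card_image_le.trans (by simp)

lemma exists_shapes (n : ℕ) (lam : ℕ → ℕ) (hpart : IsPartition lam n)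
    (R : ℕ × ℕ → ℕ) (hR : IsFinSYT lam n R) :
    ∃ Λ : ℕ → ℕ → ℕ, (∀ t i j, j < Λ t i ↔ j < lam i ∧ R (i,j) ≤ t) := by
  have hex : ∀ t i, ∃ j, ¬ (j < lam i ∧ R (i,j) ≤ t) := fun t i => ⟨lam i, by omega⟩
  refine ⟨fun t i => Nat.find (hex t i), ?_⟩
  intro t i j
  have mono : ∀ a b, a ≤ b → b < lam i → R (i,a) ≤ R (i,b) := by
    intro a b hab
    induction b, hab using Nat.le_induction with
    | base => intro _; exact le_rfl
    | succ b _ ih =>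
      intro hb
      exact (ih (by omega)).trans (hR.row_lt (i,b) hb).le
  rw [Nat.lt_find_iff]
  constructor
  · intro h
    have := h j le_rfl
    exact not_not.1 this
  · rintro ⟨h1, h2⟩ m hm
    have := mono m j hm h1
    exact not_not.2 ⟨by omega, by omega⟩

/-- Let `R` be a standard Young tableau of shape `lam ⊢ n` with at most `l` rows,
where `1 ≤ l ≤ n`.  Then there is an infinite standard Young tableau
`T ∈ SYT((∞^l))` restricting to `R` on the diagram of `lam` with `jdt^n(T) = T`. -/
theorem stmt_12 (n l : ℕ) (hn : 1 ≤ n) (hl1 : 1 ≤ l) (hln : l ≤ n)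
    (lam : ℕ → ℕ) (hpart : IsPartition lam n) (hrows : ∀ i : ℕ, l ≤ i → lam i = 0)
    (R : ℕ × ℕ → ℕ) (hR : IsFinSYT lam n R) :
    ∃ T : ℕ × ℕ → ℕ, IsSYT (l : ℕ∞) T ∧ (∀ b : ℕ × ℕ, YBox lam b → T b = R b) ∧
      (jdt (Box (l : ℕ∞)))^[n] T = T := by
  obtain ⟨Λ, hΛ⟩ := exists_shapes n lam hpart R hR
  obtain ⟨G, g1, g2, g3⟩ := exists_pat l lam hpart.antitone hrows
    (hln.trans (sum_ge n l lam hpart hrows))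
  have Λ0 : ∀ i, Λ 0 i = 0 := by
    intro i
    by_contra h
    obtain ⟨h1, h2⟩ := (hΛ 0 i 0).1 (by omega)
    have := hR.lb (i,0) h1
    omega
  have Λn : Λ n = lam := by
    funext i
    apply eq_of_forall_lt_iff
    intro j
    rw [hΛ]
    exact ⟨fun h => h.1, fun h => ⟨h, hR.ub (i,j) h⟩⟩
  have Λa : ∀ t i, Λ t (i+1) ≤ Λ t i := by
    intro t i
    apply le_of_forall_lt
    intro j hj
    rw [hΛ] at hj ⊢
    have h1 := hpart.antitone i
    have h2 := hR.col_lt (i,j) hj.1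
    simp only at h2
    exact ⟨by omega, by omega⟩
  have Λs : ∀ t, t < n → ∃ r, ∀ i, Λ (t+1) i = Λ t i + if i = r then 1 else 0 := by
    intro t ht
    obtain ⟨⟨r, d⟩, h1, h2⟩ := hR.surj (t+1) (by omega) (by omega)
    have key : ∀ i j, j < Λ (t+1) i ↔ (j < Λ t i ∨ (i = r ∧ j = d)) := by
      intro i j
      rw [hΛ, hΛ]
      constructor
      · rintro ⟨h3, h4⟩
        by_cases h5 : R (i,j) ≤ t
        · exact Or.inl ⟨h3, h5⟩
        · right
          have := hR.inj (i,j) (r,d) h3 h1 (by omega)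
          rwa [Prod.mk.injEq] at this
      · rintro (⟨h3, h4⟩ | ⟨rfl, rfl⟩)
        · exact ⟨h3, by omega⟩
        · exact ⟨h1, by omega⟩
    refine ⟨r, fun i => ?_⟩
    by_cases hi : i = r
    · subst hi
      rw [if_pos rfl]
      have nd : ¬ d < Λ t i := by rw [hΛ]; omega
      have k1 := key i d
      have k2 := key i (Λ t i)
      have k3 := key i (Λ (t+1) i)
      have k4 := key i (Λ t i + 1)
      have k5 := key i (d-1)
      omega
    · rw [if_neg hi, Nat.add_zero]
      apply eq_of_forall_lt_iff
      intro j
      rw [key]; simp [hi]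
  obtain ⟨u, u1, u2, u3⟩ := rev_word (l := l) n Λ0 Λa Λs n le_rfl G g1 (by rw [Λn]; exact g2)
  have hmod : ∀ s, s % n < n := fun s => Nat.mod_lt _ (by omega)
  have hwl : ∀ t, u (t % n) < l := fun t => u1 _ (hmod t)
  have hw : ∀ k < l, ∀ N, ∃ t, N ≤ t ∧ u (t % n) = k := by
    intro k hk N
    obtain ⟨s, hs, hsk⟩ : ∃ s < n, u s = k := by
      by_contra hcon
      push Not at hcon
      obtain ⟨i, hi⟩ := g3 k hk
      have := Pat_missing u k n hcon i
      rw [u2] at this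
      omega
    refine ⟨s + n * N, ?_, ?_⟩
    · have : 1 * N ≤ n * N := Nat.mul_le_mul_right N hn
      omega
    · rw [Nat.add_mul_mod_self_left, Nat.mod_eq_of_lt hs, hsk]
  have hgr := growth_Pat (fun s => u (s % n)) l hwl hw
  have hsh : ∀ t ≤ n, Pat (fun s => u (s % n)) t l = Λ t := by
    intro t ht
    rw [← u3 t ht]
    rw [Pat_congr (fun s => u (s % n)) u t]
    intro s hs
    rw [Nat.mod_eq_of_lt (by omega)]
  refine ⟨_, hgr.isSYT, ?_, ?_⟩
  · rintro ⟨i, j⟩ hb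
    have hil : i < l := by
      by_contra h
      have hb' : j < lam i := hb
      rw [hrows i (by omega)] at hb'
      omega
    have hub := hR.ub _ hb
    have hlb := hR.lb _ hb
    have h1 := hgr.tab_le (j := j) (t := R (i,j)) hil
    have h2 := hgr.tab_le (j := j) (t := R (i,j) - 1) hil
    rw [hsh _ (by omega), hΛ] at h1 h2
    have hb' : j < lam i := hb
    have a1 := h1.2 ⟨hb', le_rfl⟩
    have a2 : ¬ _ := fun h => absurd (h2.1 h).2 (by omega)
    omega
  · rw [jdt_iter _ l hwl hw n]
    simp only [Nat.add_mod_right]
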